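/- Let T > 0 and let V satisfy (H1) 0 ≤ V(μ)(x) ≤ V_max, (H2) |V(μ)(x) − V(μ)(y)| ≤ L |x − y|, (H3) |V(μ₁)(x) − V(μ₂)(x)| ≤ L ‖μ₁ − μ₂‖*_BL. Let (m_t)_{t ∈ [0,T]} be a measure-valued solution of ∂_t m + ∂_x(V(m_t) m) = 0 on ℝ with initial datum μ₀, i.e. a family of finite nonnegative Borel measures, continuous in the bounded-Lipschitz distance, with m_0 = μ₀, satisfying the weak formulation for all compactly supported C¹ test functions. Then there exists a flow map Φ of the time-dependent velocity field (x, t) ↦ V(m_t)(x) — i.e. Φ_0(x) = x and (d/dt) Φ_t(x) = V(m_t)(Φ_t(x)) for all t ∈ [0,T] — such that m_t = (Φ_t)_# μ₀ for every t ∈ [0,T]; that is, the solution is the push-forward of the initial datum along the characteristic flow. -/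

import Mathlib

open MeasureTheory Set

/-- The bounded-Lipschitz norm of a function: sup of |φ| plus the least Lipschitz constant. -/
noncomputable def blNorm {X : Type*} [PseudoMetricSpace X] (φ : X → ℝ) : ℝ :=
  (⨆ x, |φ x|) + sInf {K : ℝ | 0 ≤ K ∧ LipschitzWith K.toNNReal φ}

/-- A function is bounded Lipschitz. -/
def IsBoundedLipschitz {X : Type*} [PseudoMetricSpace X] (φ : X → ℝ) : Prop :=
  (∃ C, ∀ x, |φ x| ≤ C) ∧ ∃ K, LipschitzWith K φ

/-- The bounded-Lipschitz (flat) dual distance between two measures: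
`‖μ − ν‖*_BL = sup {|∫ φ dμ − ∫ φ dν| : φ bounded Lipschitz, ‖φ‖_BL ≤ 1}`. -/
noncomputable def blDist {X : Type*} [PseudoMetricSpace X] [MeasurableSpace X]
    (μ ν : Measure X) : ℝ :=
  sSup {r : ℝ | ∃ φ : X → ℝ, IsBoundedLipschitz φ ∧ blNorm φ ≤ 1 ∧
    r = |(∫ x, φ x ∂μ) - ∫ x, φ x ∂ν|}

/-- A measure-valued solution of the nonlinear transport equation
`∂ₜ m + ∂ₓ(V(m_t) m) = 0` on `[0,T]` with initial datum `μ₀`: a family of finite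
nonnegative Borel measures, continuous in time for the bounded-Lipschitz distance,
starting at `μ₀` and satisfying the weak formulation against all compactly supported
`C¹` test functions. -/
def IsMVSolution (T : ℝ) (V : Measure ℝ → ℝ → ℝ) (μ₀ : Measure ℝ)
    (m : ℝ → Measure ℝ) : Prop :=
  (∀ t ∈ Set.Icc (0:ℝ) T, IsFiniteMeasure (m t)) ∧
  (∀ t ∈ Set.Icc (0:ℝ) T, ∀ ε > (0:ℝ), ∃ δ > (0:ℝ), ∀ s ∈ Set.Icc (0:ℝ) T,
    |s - t| < δ → blDist (m s) (m t) < ε) ∧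
  m 0 = μ₀ ∧
  (∀ f : ℝ × ℝ → ℝ, ContDiff ℝ 1 f → HasCompactSupport f →
    (∫ x, f (x, T) ∂(m T)) - (∫ x, f (x, 0) ∂μ₀) =
      ∫ t in (0:ℝ)..T, ∫ x,
        (fderiv ℝ f (x, t) (0, 1) + V (m t) x * fderiv ℝ f (x, t) (1, 0)) ∂(m t))

open Filter Topology
open scoped NNReal

lemma blNorm_le {X : Type*} [PseudoMetricSpace X] {φ : X → ℝ} {C : ℝ} {K : ℝ≥0}
    (hC0 : 0 ≤ C) (hC : ∀ x, |φ x| ≤ C) (hK : LipschitzWith K φ) : blNorm φ ≤ C + K := by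
  refine add_le_add (Real.iSup_le hC hC0) (csInf_le ⟨0, fun _ h => h.1⟩ ⟨K.2, ?_⟩)
  simpa using hK

lemma abs_le_blNorm {X : Type*} [PseudoMetricSpace X] {φ : X → ℝ}
    (hφ : IsBoundedLipschitz φ) (x : X) : |φ x| ≤ blNorm φ := by
  obtain ⟨⟨C, hC⟩, -⟩ := hφ
  have h1 : |φ x| ≤ ⨆ y, |φ y| :=
    le_ciSup (f := fun y => |φ y|) ⟨C, by rintro _ ⟨y, rfl⟩; exact hC y⟩ x
  have h2 : 0 ≤ sInf {K : ℝ | 0 ≤ K ∧ LipschitzWith K.toNNReal φ} :=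
    Real.sInf_nonneg fun _ h => h.1
  exact h1.trans (le_add_of_nonneg_right h2)

lemma blDist_nonneg {X : Type*} [PseudoMetricSpace X] [MeasurableSpace X] (μ ν : Measure X) :
    0 ≤ blDist μ ν :=
  Real.sSup_nonneg <| by rintro _ ⟨φ, -, -, rfl⟩; exact abs_nonneg _

lemma abs_integral_le_mul_measureReal {X : Type*} [MeasurableSpace X] (μ : Measure X)
    [IsFiniteMeasure μ] {φ : X → ℝ} {C : ℝ} (h : ∀ x, |φ x| ≤ C) :
    |∫ x, φ x ∂μ| ≤ C * μ.real univ :=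
  (Real.norm_eq_abs _).symm.trans_le <| norm_integral_le_of_norm_le_const <|
    .of_forall fun x => (Real.norm_eq_abs _).trans_le (h x)

lemma abs_integral_sub_le_blDist {X : Type*} [PseudoMetricSpace X] [MeasurableSpace X]
    (μ ν : Measure X) [IsFiniteMeasure μ] [IsFiniteMeasure ν] {φ : X → ℝ} {C : ℝ} {K : ℝ≥0}
    (hC0 : 0 ≤ C) (hC : ∀ x, |φ x| ≤ C) (hK : LipschitzWith K φ) :
    |(∫ x, φ x ∂μ) - ∫ x, φ x ∂ν| ≤ (C + K + 1) * blDist μ ν := by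
  set D : ℝ := C + K + 1
  have hK0 : (0 : ℝ) ≤ K := K.2
  have hD : 0 < D := by positivity
  set ψ : X → ℝ := fun x => D⁻¹ * φ x
  have hψC : ∀ x, |ψ x| ≤ D⁻¹ * C := fun x => by
    rw [abs_mul, abs_of_pos (inv_pos.2 hD)]
    exact mul_le_mul_of_nonneg_left (hC x) (inv_pos.2 hD).le
  have hψK : LipschitzWith (D⁻¹.toNNReal * K) ψ := LipschitzWith.of_dist_le_mul fun x y => by
    have := hK.dist_le_mul x y
    rw [Real.dist_eq] at this ⊢
    rw [← mul_sub, abs_mul, abs_of_pos (inv_pos.2 hD), NNReal.coe_mul,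
      Real.coe_toNNReal _ (inv_pos.2 hD).le, mul_assoc]
    exact mul_le_mul_of_nonneg_left this (inv_pos.2 hD).le
  have hψ1 : blNorm ψ ≤ 1 := by
    refine (blNorm_le (by positivity) hψC hψK).trans ?_
    rw [NNReal.coe_mul, Real.coe_toNNReal _ (inv_pos.2 hD).le, ← mul_add, inv_mul_le_iff₀ hD]
    simp [D]
  have hle : |(∫ x, ψ x ∂μ) - ∫ x, ψ x ∂ν| ≤ blDist μ ν := by
    refine le_csSup ⟨μ.real univ + ν.real univ, ?_⟩ ⟨ψ, ⟨⟨_, hψC⟩, _, hψK⟩, hψ1, rfl⟩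
    rintro _ ⟨χ, hχ, hχ1, rfl⟩
    have hb : ∀ x, |χ x| ≤ 1 := fun x => (abs_le_blNorm hχ x).trans hχ1
    have h1 := abs_integral_le_mul_measureReal μ hb
    have h2 := abs_integral_le_mul_measureReal ν hb
    rw [one_mul] at h1 h2
    exact (abs_sub _ _).trans (add_le_add h1 h2)
  rw [integral_const_mul, integral_const_mul, ← mul_sub, abs_mul, abs_of_pos (inv_pos.2 hD),
    inv_mul_le_iff₀ hD] at hle
  exact hle

lemma integrable_of_bounded_lipschitz (μ : Measure ℝ) [IsFiniteMeasure μ] {φ : ℝ → ℝ}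
    {C : ℝ} {K : ℝ≥0} (hC : ∀ x, |φ x| ≤ C) (hK : LipschitzWith K φ) : Integrable φ μ :=
  .of_bound hK.continuous.aestronglyMeasurable C (.of_forall hC)

/-- Integrals of uniformly bounded Lipschitz functions varying uniformly continuously in time,
against a family of measures continuous for the bounded-Lipschitz distance, are continuous. -/
lemma continuousOn_integral_of_blDist {S : Set ℝ} {m : ℝ → Measure ℝ}
    (hfin : ∀ t ∈ S, IsFiniteMeasure (m t))
    (hcont : ∀ t ∈ S, Tendsto (fun s => blDist (m s) (m t)) (𝓝[S] t) (𝓝 0))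
    {h : ℝ → ℝ → ℝ} {C : ℝ} {K : ℝ≥0} (hC : ∀ t ∈ S, ∀ x, |h t x| ≤ C)
    (hK : ∀ t ∈ S, LipschitzWith K (h t))
    (hh : ∀ t ∈ S, ∃ ω : ℝ → ℝ, (∀ s ∈ S, ∀ x, |h s x - h t x| ≤ ω s) ∧
      Tendsto ω (𝓝[S] t) (𝓝 0)) :
    ContinuousOn (fun t => ∫ x, h t x ∂(m t)) S := by
  intro t ht
  obtain ⟨ω, hω, hω0⟩ := hh t ht
  have hC0 : 0 ≤ C := (abs_nonneg _).trans (hC t ht 0)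
  have := hfin t ht
  refine tendsto_iff_dist_tendsto_zero.2 ?_
  have hlim : Tendsto (fun s => (C + K + 1) * blDist (m s) (m t) + ω s * (m t).real univ)
      (𝓝[S] t) (𝓝 0) := by
    simpa using ((hcont t ht).const_mul (C + K + 1)).add (hω0.mul_const ((m t).real univ))
  refine squeeze_zero' (.of_forall fun _ => dist_nonneg) ?_ hlim
  filter_upwards [self_mem_nhdsWithin] with s hs
  have := hfin s hs
  have h1 := abs_integral_sub_le_blDist (m s) (m t) hC0 (hC s hs) (hK s hs)
  have h2 := abs_integral_le_mul_measureReal (m t) (hω s hs)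
  rw [integral_sub (integrable_of_bounded_lipschitz _ (hC s hs) (hK s hs))
    (integrable_of_bounded_lipschitz _ (hC t ht) (hK t ht))] at h2
  rw [Real.dist_eq]
  calc _ ≤ _ := abs_sub_le _ (∫ x, h s x ∂(m t)) _
    _ ≤ _ := add_le_add h1 h2

/-- A smooth cutoff in time, equal to `1` up to `t - δ` and to `0` from `t` on. -/
noncomputable def timeCutoff (t δ s : ℝ) : ℝ := Real.smoothTransition ((t - s) / δ)

lemma contDiff_timeCutoff (t δ : ℝ) : ContDiff ℝ 1 (timeCutoff t δ) :=
  (Real.smoothTransition.contDiff (n := 1)).comp ((contDiff_const.sub contDiff_id).div_const δ)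

lemma timeCutoff_eq_zero {t δ s : ℝ} (hδ : 0 < δ) (h : t ≤ s) : timeCutoff t δ s = 0 :=
  Real.smoothTransition.zero_of_nonpos (div_nonpos_of_nonpos_of_nonneg (by linarith) hδ.le)

lemma timeCutoff_eq_one {t δ s : ℝ} (hδ : 0 < δ) (h : s ≤ t - δ) : timeCutoff t δ s = 1 :=
  Real.smoothTransition.one_of_one_le ((one_le_div hδ).2 (by linarith))

lemma antitone_timeCutoff {t δ : ℝ} (hδ : 0 < δ) : Antitone (timeCutoff t δ) := fun _ _ h =>
  Real.smoothTransition.monotone (div_le_div_of_nonneg_right (by linarith) hδ.le)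

/-- If `g' = h` holds in the weak sense when tested against time cutoffs, then the increments of
`g` are controlled by the integral of `|h|`. -/
lemma abs_sub_le_integral_of_timeCutoff {T t : ℝ} (ht0 : 0 < t) (htT : t ≤ T) {g h : ℝ → ℝ}
    (hg : ContinuousOn g (Icc 0 T)) (hh : ContinuousOn h (Icc 0 T))
    (H : ∀ δ, 0 < δ → δ < t →
      -g 0 = ∫ s in (0:ℝ)..T, (deriv (timeCutoff t δ) s * g s + timeCutoff t δ s * h s)) :
    |g t - g 0| ≤ ∫ s in (0:ℝ)..T, |h s| := by
  have hT : 0 ≤ T := ht0.le.trans htT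
  have ht : t ∈ Icc 0 T := ⟨ht0.le, htT⟩
  refine le_of_forall_pos_le_add fun η hη => ?_
  obtain ⟨ε, hε, hgε⟩ := Metric.continuousOn_iff.1 hg t ht η hη
  obtain ⟨δ, hδ, hδ'⟩ := exists_between (lt_min hε ht0)
  obtain ⟨hδε, hδt⟩ := lt_min_iff.1 hδ'
  set χ := timeCutoff t δ with hχ
  have hχc : ContDiff ℝ 1 χ := contDiff_timeCutoff t δ
  have hχd : Continuous (deriv χ) := hχc.continuous_deriv le_rfl
  have hχ' : ∀ s, deriv χ s ≤ 0 := fun s => (antitone_timeCutoff hδ).deriv_nonpos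
  have hu : uIcc 0 T = Icc 0 T := uIcc_of_le hT
  have hint : ∫ s in (0:ℝ)..T, deriv χ s = -1 := by
    rw [intervalIntegral.integral_deriv_eq_sub
      (fun s _ => (hχc.differentiable one_ne_zero).differentiableAt) (hχd.intervalIntegrable _ _),
      hχ, timeCutoff_eq_zero hδ htT, timeCutoff_eq_one hδ (by linarith)]
    norm_num
  have i1 : IntervalIntegrable (fun s => deriv χ s * (g s - g t)) volume 0 T :=
    ContinuousOn.intervalIntegrable (hu ▸ hχd.continuousOn.mul (hg.sub continuousOn_const))
  have i2 : IntervalIntegrable (fun s => deriv χ s * g t) volume 0 T :=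
    (hχd.mul continuous_const).intervalIntegrable _ _
  have i3 : IntervalIntegrable (fun s => χ s * h s) volume 0 T :=
    ContinuousOn.intervalIntegrable (hu ▸ hχc.continuous.continuousOn.mul hh)
  have i4 : IntervalIntegrable (fun s => |h s|) volume 0 T :=
    ContinuousOn.intervalIntegrable (hu ▸ hh.abs)
  have i5 : IntervalIntegrable (fun s => -deriv χ s * η) volume 0 T :=
    (hχd.neg.mul continuous_const).intervalIntegrable _ _
  have key : g t - g 0 = ∫ s in (0:ℝ)..T, (deriv χ s * (g s - g t) + χ s * h s) := by
    have e : ∀ s, deriv χ s * g s + χ s * h s =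
        (deriv χ s * (g s - g t) + χ s * h s) + deriv χ s * g t := fun s => by ring
    have h1 := H δ hδ hδt
    simp only [← hχ, e] at h1
    rw [intervalIntegral.integral_add (i1.add i3) i2, intervalIntegral.integral_mul_const,
      hint] at h1
    linarith
  rw [key]
  calc |∫ s in (0:ℝ)..T, (deriv χ s * (g s - g t) + χ s * h s)|
      ≤ ∫ s in (0:ℝ)..T, |deriv χ s * (g s - g t) + χ s * h s| :=
        intervalIntegral.abs_integral_le_integral_abs hT
    _ ≤ ∫ s in (0:ℝ)..T, (|h s| + -deriv χ s * η) := by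
        refine intervalIntegral.integral_mono_on hT (i1.add i3).abs (i4.add i5) fun s hs => ?_
        have hχ1 : |χ s * h s| ≤ |h s| := by
          rw [abs_mul, abs_of_nonneg (show 0 ≤ χ s from Real.smoothTransition.nonneg _)]
          exact mul_le_of_le_one_left (abs_nonneg _) (Real.smoothTransition.le_one _)
        have hχ2 : |deriv χ s * (g s - g t)| ≤ -deriv χ s * η := by
          rw [abs_mul, abs_of_nonpos (hχ' s)]
          by_cases hst : |s - t| < ε
          · exact mul_le_mul_of_nonneg_left (hgε s hs hst).le (neg_nonneg.2 (hχ' s))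
          · have : deriv χ s = 0 := by
              rcases le_total s t with h' | h'
              · rw [abs_of_nonpos (by linarith)] at hst
                have : χ =ᶠ[𝓝 s] fun _ => 1 := by
                  filter_upwards [Iio_mem_nhds (show s < t - δ by linarith)] with r hr
                  exact timeCutoff_eq_one hδ (le_of_lt hr)
                rw [this.deriv_eq, deriv_const]
              · rw [abs_of_nonneg (by linarith)] at hst
                have : χ =ᶠ[𝓝 s] fun _ => 0 := by
                  filter_upwards [Ioi_mem_nhds (show t < s by linarith)] with r hr
                  exact timeCutoff_eq_zero hδ (le_of_lt hr)
                rw [this.deriv_eq, deriv_const]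
            simp [this]
        linarith [abs_add_le (deriv χ s * (g s - g t)) (χ s * h s)]
    _ = (∫ s in (0:ℝ)..T, |h s|) + η := by
        rw [intervalIntegral.integral_add i4 i5, intervalIntegral.integral_mul_const,
          intervalIntegral.integral_neg, hint]
        ring

/-- A family of finite measures on `[0,T]` and a bounded velocity field, Lipschitz in space and
controlled in time by the bounded-Lipschitz distance of the measures. -/
structure IsTransportField (T M : ℝ) (L : ℝ≥0) (m : ℝ → Measure ℝ) (v : ℝ → ℝ → ℝ) : Prop where
  finite : ∀ t ∈ Icc 0 T, IsFiniteMeasure (m t)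
  tendsto_blDist : ∀ t ∈ Icc 0 T, Tendsto (fun s => blDist (m s) (m t)) (𝓝[Icc 0 T] t) (𝓝 0)
  abs_le : ∀ t ∈ Icc 0 T, ∀ x, |v t x| ≤ M
  lipschitz : ∀ t ∈ Icc 0 T, LipschitzWith L (v t)
  abs_sub_le : ∀ t ∈ Icc 0 T, ∀ s ∈ Icc 0 T, ∀ x, |v s x - v t x| ≤ L * blDist (m s) (m t)

/-- A globally defined `C¹` curve which is a characteristic of `v` on `[0,T]`. -/
structure IsCharacteristic (T : ℝ) (v : ℝ → ℝ → ℝ) (a w : ℝ → ℝ) : Prop where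
  hasDerivAt : ∀ s, HasDerivAt a (w s) s
  continuous_velocity : Continuous w
  velocity_eq : ∀ s ∈ Icc 0 T, w s = v s (a s)

/-- A `C^{1,1}` transition from `0` on the nonpositive reals to `1` on `[1, ∞)`. -/
structure IsStep (ρ : ℝ → ℝ) (C : ℝ≥0) : Prop where
  contDiff : ContDiff ℝ 1 ρ
  abs_le : ∀ x, |ρ x| ≤ 1
  abs_deriv_le : ∀ x, |deriv ρ x| ≤ C
  lipschitz_deriv : LipschitzWith C (deriv ρ)
  eq_zero : ∀ x ≤ 0, ρ x = 0
  eq_one : ∀ x, 1 ≤ x → ρ x = 1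

namespace IsStep

variable {ρ : ℝ → ℝ} {C : ℝ≥0}

lemma hasDerivAt (hρ : IsStep ρ C) (x : ℝ) : HasDerivAt ρ (deriv ρ x) x :=
  (hρ.contDiff.differentiable one_ne_zero x).hasDerivAt

lemma lipschitz (hρ : IsStep ρ C) : LipschitzWith C ρ :=
  lipschitzWith_of_nnnorm_deriv_le (hρ.contDiff.differentiable one_ne_zero) fun x =>
    hρ.abs_deriv_le x

end IsStep

lemma lipschitzWith_comp_sub_const {C : ℝ≥0} {φ : ℝ → ℝ} (hφ : LipschitzWith C φ) (a : ℝ) :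
    LipschitzWith C fun x => φ (x - a) :=
  LipschitzWith.of_dist_le_mul fun x y => by
    simpa [Real.dist_eq] using hφ.dist_le_mul (x - a) (y - a)

lemma tendsto_abs_sub_self {f : ℝ → ℝ} (hf : Continuous f) (S : Set ℝ) (t : ℝ) :
    Tendsto (fun s => |f s - f t|) (𝓝[S] t) (𝓝 0) := by
  have h : Continuous fun s => |f s - f t| := (hf.sub continuous_const).abs
  simpa using (h.tendsto t).mono_left nhdsWithin_le_nhds

section Characteristics

variable {T M : ℝ} {L C : ℝ≥0} {m : ℝ → Measure ℝ} {v : ℝ → ℝ → ℝ} {a w ρ : ℝ → ℝ}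

lemma IsCharacteristic.continuous (ha : IsCharacteristic T v a w) : Continuous a :=
  continuous_iff_continuousAt.2 fun s => (ha.hasDerivAt s).continuousAt

lemma IsCharacteristic.contDiff (ha : IsCharacteristic T v a w) : ContDiff ℝ 1 a :=
  contDiff_one_iff_deriv.2 ⟨fun s => (ha.hasDerivAt s).differentiableAt, by
    rw [funext fun s => (ha.hasDerivAt s).deriv]; exact ha.continuous_velocity⟩

/-- The relative flux through a smoothed characteristic is bounded. -/
lemma abs_flux_le (hv : IsTransportField T M L m v) (ha : IsCharacteristic T v a w)
    (hρ : IsStep ρ C) {s : ℝ} (hs : s ∈ Icc 0 T) (x : ℝ) :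
    |deriv ρ (x - a s) * (v s x - w s)| ≤ C * (2 * M) := by
  rw [abs_mul, ha.velocity_eq s hs]
  refine mul_le_mul (hρ.abs_deriv_le _) ?_ (abs_nonneg _) C.2
  linarith [abs_sub (v s x) (v s (a s)), hv.abs_le s hs x, hv.abs_le s hs (a s)]

lemma lipschitz_flux (hv : IsTransportField T M L m v) (ha : IsCharacteristic T v a w)
    (hρ : IsStep ρ C) {s : ℝ} (hs : s ∈ Icc 0 T) :
    LipschitzWith (C * L + C * (2 * M).toNNReal)
      fun x => deriv ρ (x - a s) * (v s x - w s) :=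
  LipschitzWith.of_dist_le_mul fun x y => by
    have h0 := hv.abs_le s hs
    have hM : 0 ≤ M := (abs_nonneg _).trans (h0 0)
    have h1 : |v s x - v s y| ≤ L * |x - y| := (hv.lipschitz s hs).dist_le_mul x y
    have h2 : |deriv ρ (x - a s) - deriv ρ (y - a s)| ≤ C * |x - y| := by
      simpa [Real.dist_eq] using hρ.lipschitz_deriv.dist_le_mul (x - a s) (y - a s)
    have h3 : |v s y - w s| ≤ 2 * M := by
      rw [ha.velocity_eq s hs]
      linarith [abs_sub (v s y) (v s (a s)), h0 y, h0 (a s)]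
    have e : deriv ρ (x - a s) * (v s x - w s) - deriv ρ (y - a s) * (v s y - w s) =
        deriv ρ (x - a s) * (v s x - v s y) +
          (deriv ρ (x - a s) - deriv ρ (y - a s)) * (v s y - w s) := by ring
    rw [Real.dist_eq, Real.dist_eq, e, NNReal.coe_add, NNReal.coe_mul, NNReal.coe_mul,
      Real.coe_toNNReal _ (by linarith)]
    refine (abs_add_le _ _).trans ?_
    rw [abs_mul, abs_mul]
    have h4 := mul_le_mul (hρ.abs_deriv_le (x - a s)) h1 (abs_nonneg _) C.2
    have h5 := mul_le_mul h2 h3 (abs_nonneg _) (by positivity)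
    calc _ ≤ _ := add_le_add h4 h5
      _ = _ := by ring

lemma continuousOn_integral_flux (hv : IsTransportField T M L m v)
    (ha : IsCharacteristic T v a w) (hρ : IsStep ρ C) :
    ContinuousOn (fun s => ∫ x, deriv ρ (x - a s) * (v s x - w s) ∂(m s)) (Icc 0 T) := by
  refine continuousOn_integral_of_blDist hv.finite hv.tendsto_blDist
    (fun s hs => abs_flux_le hv ha hρ hs) (fun s hs => lipschitz_flux hv ha hρ hs) fun t ht => ?_
  refine ⟨fun s => C * (L * blDist (m s) (m t) + |w s - w t|) + C * |a s - a t| * (2 * M),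
    fun s hs x => ?_, ?_⟩
  · have h1 : |v s x - w s - (v t x - w t)| ≤ L * blDist (m s) (m t) + |w s - w t| := by
      have e : v s x - w s - (v t x - w t) = (v s x - v t x) - (w s - w t) := by ring
      rw [e]
      exact (abs_sub _ _).trans (add_le_add_left (hv.abs_sub_le t ht s hs x) _)
    have h2 : |deriv ρ (x - a s) - deriv ρ (x - a t)| ≤ C * |a s - a t| := by
      have := hρ.lipschitz_deriv.dist_le_mul (x - a s) (x - a t)
      rwa [Real.dist_eq, Real.dist_eq, sub_sub_sub_cancel_left, abs_sub_comm (a t)] at this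
    have h3 : |v t x - w t| ≤ 2 * M := by
      rw [ha.velocity_eq t ht]
      linarith [abs_sub (v t x) (v t (a t)), hv.abs_le t ht x, hv.abs_le t ht (a t)]
    have e : deriv ρ (x - a s) * (v s x - w s) - deriv ρ (x - a t) * (v t x - w t) =
        deriv ρ (x - a s) * (v s x - w s - (v t x - w t)) +
          (deriv ρ (x - a s) - deriv ρ (x - a t)) * (v t x - w t) := by ring
    rw [e]
    refine (abs_add_le _ _).trans ?_
    rw [abs_mul, abs_mul]
    exact add_le_add (mul_le_mul (hρ.abs_deriv_le _) h1 (abs_nonneg _) C.2)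
      (mul_le_mul h2 h3 (abs_nonneg _) (by positivity))
  · have hw := tendsto_abs_sub_self ha.continuous_velocity (Icc 0 T) t
    have haa := tendsto_abs_sub_self ha.continuous (Icc 0 T) t
    simpa using (((hv.tendsto_blDist t ht).const_mul (L : ℝ)).add hw |>.const_mul (C : ℝ)).add
      ((haa.const_mul (C : ℝ)).mul_const (2 * M))

lemma continuousOn_integral_step (hv : IsTransportField T M L m v)
    (ha : IsCharacteristic T v a w) (hρ : IsStep ρ C) :
    ContinuousOn (fun s => ∫ x, ρ (x - a s) ∂(m s)) (Icc 0 T) := by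
  refine continuousOn_integral_of_blDist hv.finite hv.tendsto_blDist
    (fun s _ x => hρ.abs_le _) (fun s _ => lipschitzWith_comp_sub_const hρ.lipschitz _) fun t ht => ?_
  refine ⟨fun s => C * |a s - a t|, fun s hs x => ?_, ?_⟩
  · have := hρ.lipschitz.dist_le_mul (x - a s) (x - a t)
    rwa [Real.dist_eq, Real.dist_eq, sub_sub_sub_cancel_left, abs_sub_comm (a t)] at this
  · simpa using (tendsto_abs_sub_self ha.continuous (Icc 0 T) t).const_mul (C : ℝ)

end Characteristics

/-- The weak formulation on `[0,T]` of the transport equation with velocity field `v`. -/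
def IsWeakSolution (T : ℝ) (m : ℝ → Measure ℝ) (v : ℝ → ℝ → ℝ) : Prop :=
  ∀ f : ℝ × ℝ → ℝ, ContDiff ℝ 1 f → HasCompactSupport f →
    (∫ x, f (x, T) ∂(m T)) - (∫ x, f (x, 0) ∂(m 0)) =
      ∫ t in (0:ℝ)..T, ∫ x,
        (fderiv ℝ f (x, t) (0, 1) + v t x * fderiv ℝ f (x, t) (1, 0)) ∂(m t)

/-- The test function localised between two curves `a` and `b` and before time `t`. -/
noncomputable def stripTest (ρ a b : ℝ → ℝ) (t δ : ℝ) (p : ℝ × ℝ) : ℝ :=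
  timeCutoff t δ p.2 * Real.smoothTransition (p.2 + 2) * (ρ (p.1 - a p.2) - ρ (p.1 - b p.2))

section StripTest

variable {T M : ℝ} {L C : ℝ≥0} {m : ℝ → Measure ℝ} {v : ℝ → ℝ → ℝ}
  {a b wa wb ρ : ℝ → ℝ} {t δ : ℝ}

lemma contDiff_stripTest (ha : IsCharacteristic T v a wa) (hb : IsCharacteristic T v b wb)
    (hρ : IsStep ρ C) : ContDiff ℝ 1 (stripTest ρ a b t δ) :=
  (((contDiff_timeCutoff t δ).comp contDiff_snd).mul
    ((Real.smoothTransition.contDiff (n := 1)).comp (contDiff_snd.add contDiff_const))).mul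
    ((hρ.contDiff.comp (contDiff_fst.sub (ha.contDiff.comp contDiff_snd))).sub
      (hρ.contDiff.comp (contDiff_fst.sub (hb.contDiff.comp contDiff_snd))))

lemma hasFDerivAt_stripTest (ha : IsCharacteristic T v a wa) (hb : IsCharacteristic T v b wb)
    (hρ : IsStep ρ C) (p : ℝ × ℝ) :
    HasFDerivAt (stripTest ρ a b t δ) (fderiv ℝ (stripTest ρ a b t δ) p) p :=
  ((contDiff_stripTest ha hb hρ).differentiable one_ne_zero p).hasFDerivAt

lemma hasCompactSupport_stripTest (ha : IsCharacteristic T v a wa)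
    (hb : IsCharacteristic T v b wb) (hρ : IsStep ρ C) (hδ : 0 < δ) :
    HasCompactSupport (stripTest ρ a b t δ) := by
  obtain ⟨A, hA⟩ := (isCompact_Icc (a := -2) (b := t)).exists_bound_of_continuousOn
    ha.continuous.continuousOn
  obtain ⟨B, hB⟩ := (isCompact_Icc (a := -2) (b := t)).exists_bound_of_continuousOn
    hb.continuous.continuousOn
  refine HasCompactSupport.intro (K := Icc (-(|A| + |B|)) (|A| + |B| + 1) ×ˢ Icc (-2) t)
    (isCompact_Icc.prod isCompact_Icc) fun p hp => ?_
  rw [stripTest]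
  rcases lt_or_ge t p.2 with h | h2
  · simp [timeCutoff_eq_zero hδ h.le]
  rcases lt_or_ge p.2 (-2) with h | h1
  · simp [Real.smoothTransition.zero_of_nonpos (show p.2 + 2 ≤ 0 by linarith)]
  have hA' := abs_le.1 ((hA p.2 ⟨h1, h2⟩).trans (le_abs_self A))
  have hB' := abs_le.1 ((hB p.2 ⟨h1, h2⟩).trans (le_abs_self B))
  have hA0 := abs_nonneg A
  have hB0 := abs_nonneg B
  rcases lt_or_ge p.1 (-(|A| + |B|)) with h | h3
  · rw [hρ.eq_zero _ (by linarith), hρ.eq_zero _ (by linarith), sub_zero, mul_zero]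
  rcases lt_or_ge (|A| + |B| + 1) p.1 with h | h4
  · rw [hρ.eq_one _ (by linarith), hρ.eq_one _ (by linarith), sub_self, mul_zero]
  exact absurd ⟨⟨h3, h4⟩, h1, h2⟩ hp

lemma stripTest_eq {s : ℝ} (hs : 0 ≤ s) (x : ℝ) :
    stripTest ρ a b t δ (x, s) = timeCutoff t δ s * (ρ (x - a s) - ρ (x - b s)) := by
  simp [stripTest, Real.smoothTransition.one_of_one_le (show 1 ≤ s + 2 by linarith)]

lemma fderiv_stripTest_fst (ha : IsCharacteristic T v a wa) (hb : IsCharacteristic T v b wb)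
    (hρ : IsStep ρ C) {s : ℝ} (hs : 0 ≤ s) (x : ℝ) :
    fderiv ℝ (stripTest ρ a b t δ) (x, s) (1, 0) =
      timeCutoff t δ s * (deriv ρ (x - a s) - deriv ρ (x - b s)) := by
  have h1 := (hasFDerivAt_stripTest (t := t) (δ := δ) ha hb hρ (x, s)).comp_hasDerivAt x
    ((hasDerivAt_id' x).prodMk (hasDerivAt_const x s))
  refine h1.unique ?_
  simp only [Function.comp_def, stripTest_eq hs]
  exact (((hρ.hasDerivAt (x - a s)).comp_sub_const x (a s)).sub
    ((hρ.hasDerivAt (x - b s)).comp_sub_const x (b s))).const_mul _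

lemma fderiv_stripTest_snd (ha : IsCharacteristic T v a wa) (hb : IsCharacteristic T v b wb)
    (hρ : IsStep ρ C) {s : ℝ} (hs : 0 ≤ s) (x : ℝ) :
    fderiv ℝ (stripTest ρ a b t δ) (x, s) (0, 1) =
      deriv (timeCutoff t δ) s * (ρ (x - a s) - ρ (x - b s)) +
        timeCutoff t δ s * (deriv ρ (x - a s) * -wa s - deriv ρ (x - b s) * -wb s) := by
  have h1 := (hasFDerivAt_stripTest (t := t) (δ := δ) ha hb hρ (x, s)).comp_hasDerivAt s
    ((hasDerivAt_const s x).prodMk (hasDerivAt_id' s))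
  refine h1.unique ?_
  have h2 : (fun r => stripTest ρ a b t δ (x, r)) =ᶠ[𝓝 s]
      fun r => timeCutoff t δ r * (ρ (x - a r) - ρ (x - b r)) := by
    filter_upwards [Ioi_mem_nhds (show -1 < s by linarith)] with r hr
    have hr' : -1 < r := hr
    simp [stripTest, Real.smoothTransition.one_of_one_le (show 1 ≤ r + 2 by linarith)]
  refine HasDerivAt.congr_of_eventuallyEq ?_ h2
  have hχ := ((contDiff_timeCutoff t δ).differentiable one_ne_zero s).hasDerivAt
  exact hχ.mul (((hρ.hasDerivAt (x - a s)).comp s ((ha.hasDerivAt s).const_sub x)).sub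
    ((hρ.hasDerivAt (x - b s)).comp s ((hb.hasDerivAt s).const_sub x)))

/-- The smoothed mass between two characteristics varies at most by the relative fluxes through
them. -/
lemma abs_sub_stripMass_le (hv : IsTransportField T M L m v) (hm : IsWeakSolution T m v)
    (ha : IsCharacteristic T v a wa) (hb : IsCharacteristic T v b wb) (hρ : IsStep ρ C)
    (ht0 : 0 < t) (htT : t ≤ T) :
    |((∫ x, ρ (x - a t) ∂(m t)) - ∫ x, ρ (x - b t) ∂(m t)) -
        ((∫ x, ρ (x - a 0) ∂(m 0)) - ∫ x, ρ (x - b 0) ∂(m 0))| ≤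
      ∫ s in (0:ℝ)..T, |(∫ x, deriv ρ (x - a s) * (v s x - wa s) ∂(m s)) -
        ∫ x, deriv ρ (x - b s) * (v s x - wb s) ∂(m s)| := by
  have hT : 0 ≤ T := ht0.le.trans htT
  refine abs_sub_le_integral_of_timeCutoff ht0 htT
    (g := fun s => (∫ x, ρ (x - a s) ∂(m s)) - ∫ x, ρ (x - b s) ∂(m s))
    (h := fun s => (∫ x, deriv ρ (x - a s) * (v s x - wa s) ∂(m s)) -
        ∫ x, deriv ρ (x - b s) * (v s x - wb s) ∂(m s))
    ((continuousOn_integral_step hv ha hρ).sub (continuousOn_integral_step hv hb hρ))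
    ((continuousOn_integral_flux hv ha hρ).sub (continuousOn_integral_flux hv hb hρ))
    fun δ hδ hδt => ?_
  have hint : ∀ {c wc : ℝ → ℝ}, IsCharacteristic T v c wc → ∀ s ∈ Icc 0 T,
      Integrable (fun x => ρ (x - c s)) (m s) ∧
        Integrable (fun x => deriv ρ (x - c s) * (v s x - wc s)) (m s) := fun hc s hs =>
    have := hv.finite s hs
    ⟨integrable_of_bounded_lipschitz _ (fun x => hρ.abs_le _)
      (lipschitzWith_comp_sub_const hρ.lipschitz _),
    integrable_of_bounded_lipschitz _ (abs_flux_le hv hc hρ hs) (lipschitz_flux hv hc hρ hs)⟩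
  have h0 : (0:ℝ) ∈ Icc 0 T := left_mem_Icc.2 hT
  have key := hm _ (contDiff_stripTest (t := t) (δ := δ) ha hb hρ)
    (hasCompactSupport_stripTest ha hb hρ hδ)
  simp only [stripTest_eq hT, stripTest_eq le_rfl, timeCutoff_eq_zero hδ htT,
    timeCutoff_eq_one hδ (show 0 ≤ t - δ by linarith), zero_mul, one_mul, integral_zero,
    zero_sub] at key
  rw [integral_sub (hint ha 0 h0).1 (hint hb 0 h0).1] at key
  rw [key]
  refine intervalIntegral.integral_congr fun s hs => ?_
  rw [uIcc_of_le hT] at hs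
  have e : ∀ x, fderiv ℝ (stripTest ρ a b t δ) (x, s) (0, 1) +
      v s x * fderiv ℝ (stripTest ρ a b t δ) (x, s) (1, 0) =
      deriv (timeCutoff t δ) s * (ρ (x - a s) - ρ (x - b s)) +
        timeCutoff t δ s * (deriv ρ (x - a s) * (v s x - wa s) -
          deriv ρ (x - b s) * (v s x - wb s)) := fun x => by
    rw [fderiv_stripTest_fst ha hb hρ hs.1, fderiv_stripTest_snd ha hb hρ hs.1]
    ring
  obtain ⟨ia, ja⟩ := hint ha s hs
  obtain ⟨ib, jb⟩ := hint hb s hs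
  simp only [e]
  have i1 : Integrable (fun x => deriv (timeCutoff t δ) s * (ρ (x - a s) - ρ (x - b s))) (m s) :=
    (ia.sub ib).const_mul _
  have i2 : Integrable (fun x => timeCutoff t δ s * (deriv ρ (x - a s) * (v s x - wa s) -
      deriv ρ (x - b s) * (v s x - wb s))) (m s) := (ja.sub jb).const_mul _
  rw [integral_add i1 i2, integral_const_mul, integral_const_mul, integral_sub ia ib,
    integral_sub ja jb]

end StripTest

lemma deriv_smoothTransition_eq_zero {x : ℝ} (hx : x ≤ 0 ∨ 1 ≤ x) :
    deriv Real.smoothTransition x = 0 := by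
  rcases hx with hx | hx
  · refine IsLocalMin.deriv_eq_zero (.of_forall fun y => ?_)
    rw [Real.smoothTransition.zero_of_nonpos hx]
    exact Real.smoothTransition.nonneg y
  · refine IsLocalMax.deriv_eq_zero (.of_forall fun y => ?_)
    rw [Real.smoothTransition.one_of_one_le hx]
    exact Real.smoothTransition.le_one y

lemma exists_isStep_smoothTransition : ∃ C : ℝ≥0, IsStep Real.smoothTransition C := by
  have h2 : ContDiff ℝ (1 + 1) Real.smoothTransition := Real.smoothTransition.contDiff (n := 2)
  have hd : ContDiff ℝ 1 (deriv Real.smoothTransition) := (contDiff_succ_iff_deriv.1 h2).2.2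
  have hs : HasCompactSupport (deriv Real.smoothTransition) :=
    HasCompactSupport.intro (isCompact_Icc (a := 0) (b := 1)) fun x hx =>
      deriv_smoothTransition_eq_zero <| by
        by_contra! h
        exact hx ⟨h.1.le, h.2.le⟩
  obtain ⟨C₁, h₁⟩ := hd.lipschitzWith_of_hasCompactSupport hs one_ne_zero
  obtain ⟨C₂, h₂⟩ := hs.exists_bound_of_continuous hd.continuous
  refine ⟨max C₁ C₂.toNNReal, Real.smoothTransition.contDiff (n := 1), fun x => ?_, fun x => ?_,
    h₁.weaken (le_max_left _ _), fun x => Real.smoothTransition.zero_of_nonpos,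
    fun x => Real.smoothTransition.one_of_one_le⟩
  · rw [abs_of_nonneg (Real.smoothTransition.nonneg x)]
    exact Real.smoothTransition.le_one x
  · exact (h₂ x).trans ((Real.le_coe_toNNReal _).trans (NNReal.coe_le_coe.2 (le_max_right _ _)))

/-- Smooth transitions from `0` to `1` on `[0, 1/(n+1)]`. -/
noncomputable def scaledStep (n : ℕ) (x : ℝ) : ℝ := Real.smoothTransition ((n + 1) * x)

section ScaledStep

variable {T M : ℝ} {L C : ℝ≥0} {m : ℝ → Measure ℝ} {v : ℝ → ℝ → ℝ} {a b w wa wb : ℝ → ℝ}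

lemma deriv_scaledStep (n : ℕ) (x : ℝ) :
    deriv (scaledStep n) x = (n + 1) * deriv Real.smoothTransition ((n + 1) * x) :=
  deriv_comp_mul_left (n + 1 : ℝ) Real.smoothTransition x

lemma isStep_scaledStep (hC : IsStep Real.smoothTransition C) (n : ℕ) :
    IsStep (scaledStep n) (C * (n + 1) ^ 2) where
  contDiff := hC.contDiff.comp (contDiff_const.mul contDiff_id)
  abs_le x := hC.abs_le _
  abs_deriv_le x := by
    have hn : (0 : ℝ) ≤ n := n.cast_nonneg
    rw [deriv_scaledStep, abs_mul, abs_of_nonneg (by positivity)]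
    have h := mul_le_mul_of_nonneg_left (hC.abs_deriv_le ((n + 1) * x))
      (show (0 : ℝ) ≤ n + 1 by positivity)
    have hC0 : (0 : ℝ) ≤ C := C.2
    push_cast
    nlinarith [mul_nonneg hC0 hn, mul_nonneg (mul_nonneg hC0 hn) hn]
  lipschitz_deriv := LipschitzWith.of_dist_le_mul fun x y => by
    have h := hC.lipschitz_deriv.dist_le_mul ((n + 1) * x) ((n + 1) * y)
    have hn : (0 : ℝ) ≤ n + 1 := by positivity
    rw [Real.dist_eq, Real.dist_eq, ← mul_sub, abs_mul, abs_of_nonneg hn] at h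
    rw [Real.dist_eq, Real.dist_eq, deriv_scaledStep, deriv_scaledStep, ← mul_sub, abs_mul,
      abs_of_nonneg hn]
    push_cast
    calc _ ≤ _ := mul_le_mul_of_nonneg_left h hn
      _ = _ := by ring
  eq_zero x hx := hC.eq_zero _ (mul_nonpos_of_nonneg_of_nonpos (by positivity) hx)
  eq_one x hx := hC.eq_one _ (by nlinarith [n.cast_nonneg (α := ℝ)])

lemma eventually_one_le_mul {y : ℝ} (hy : 0 < y) : ∀ᶠ n : ℕ in atTop, 1 ≤ ((n : ℝ) + 1) * y := by
  obtain ⟨N, hN⟩ := exists_nat_ge (1 / y)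
  filter_upwards [eventually_ge_atTop N] with n hn
  have : (N : ℝ) ≤ n := Nat.cast_le.2 hn
  rw [div_le_iff₀ hy] at hN
  nlinarith

lemma tendsto_integral_scaledStep (μ : Measure ℝ) [IsFiniteMeasure μ] (c : ℝ) :
    Tendsto (fun n => ∫ x, scaledStep n (x - c) ∂μ) atTop (𝓝 (μ.real (Ioi c))) := by
  obtain ⟨C, hC⟩ := exists_isStep_smoothTransition
  rw [← integral_indicator_one measurableSet_Ioi]
  refine tendsto_integral_of_dominated_convergence (fun _ => 1)
    (fun n => ((isStep_scaledStep hC n).contDiff.continuous.comp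
      (continuous_id.sub continuous_const)).aestronglyMeasurable)
    (integrable_const _) (fun n => .of_forall fun x => (isStep_scaledStep hC n).abs_le _)
    (.of_forall fun x => ?_)
  rcases le_or_gt x c with h | h
  · have h' : ∀ n, scaledStep n (x - c) = 0 := fun n =>
      (isStep_scaledStep hC n).eq_zero _ (by linarith)
    simp [h', h]
  · rw [indicator_of_mem (show x ∈ Ioi c from h)]
    refine tendsto_const_nhds.congr' ?_
    filter_upwards [eventually_one_le_mul (sub_pos.2 h)] with n hn
    exact (Real.smoothTransition.one_of_one_le hn).symm

lemma abs_scaledFlux_le (hC : IsStep Real.smoothTransition C) {u : ℝ → ℝ}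
    (hu : LipschitzWith L u) (n : ℕ) (c x : ℝ) :
    |deriv (scaledStep n) (x - c) * (u x - u c)| ≤ C * L := by
  rw [deriv_scaledStep]
  by_cases h : (n + 1) * (x - c) ≤ 0 ∨ 1 ≤ (n + 1) * (x - c)
  · rw [deriv_smoothTransition_eq_zero h, mul_zero, zero_mul, abs_zero]
    positivity
  · push Not at h
    have hn : (0 : ℝ) < n + 1 := by positivity
    have hxc : 0 < x - c := pos_of_mul_pos_right h.1 hn.le
    have h1 : |u x - u c| ≤ L * |x - c| := hu.dist_le_mul x c
    rw [abs_of_pos hxc] at h1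
    have h2 := mul_le_mul (hC.abs_deriv_le ((n + 1) * (x - c))) h1 (abs_nonneg _) C.2
    rw [abs_mul, abs_mul, abs_of_pos hn, mul_assoc]
    calc _ ≤ _ := mul_le_mul_of_nonneg_left h2 hn.le
      _ = C * L * ((n + 1) * (x - c)) := by ring
      _ ≤ C * L * 1 := mul_le_mul_of_nonneg_left h.2.le (by positivity)
      _ = C * L := mul_one _

lemma tendsto_integral_scaledFlux (μ : Measure ℝ) [IsFiniteMeasure μ] {u : ℝ → ℝ}
    (hu : LipschitzWith L u) (c : ℝ) :
    Tendsto (fun n => ∫ x, deriv (scaledStep n) (x - c) * (u x - u c) ∂μ) atTop (𝓝 0) := by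
  obtain ⟨C, hC⟩ := exists_isStep_smoothTransition
  rw [← integral_zero ℝ ℝ (μ := μ)]
  refine tendsto_integral_of_dominated_convergence (fun _ => (C * L : ℝ)) (fun n => ?_)
    (integrable_const _) (fun n => .of_forall fun x => abs_scaledFlux_le hC hu n c x)
    (.of_forall fun x => tendsto_const_nhds.congr' ?_)
  · exact (((isStep_scaledStep hC n).lipschitz_deriv.continuous.comp
      (continuous_id.sub continuous_const)).mul
        (hu.continuous.sub continuous_const)).aestronglyMeasurable
  · have h : ∀ᶠ n : ℕ in atTop, ((n : ℝ) + 1) * (x - c) ≤ 0 ∨ 1 ≤ ((n : ℝ) + 1) * (x - c) := by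
      rcases le_or_gt x c with h | h
      · exact .of_forall fun n =>
          .inl (mul_nonpos_of_nonneg_of_nonpos (by positivity) (by linarith))
      · exact (eventually_one_le_mul (sub_pos.2 h)).mono fun n hn => .inr hn
    filter_upwards [h] with n hn
    rw [deriv_scaledStep, deriv_smoothTransition_eq_zero hn, mul_zero, zero_mul]

lemma continuousOn_measureReal_univ (hv : IsTransportField T M L m v) :
    ContinuousOn (fun s => (m s).real univ) (Icc 0 T) := by
  have := continuousOn_integral_of_blDist hv.finite hv.tendsto_blDist (h := fun _ _ => 1) (C := 1)
    (K := 0) (fun _ _ _ => by simp) (fun _ _ => LipschitzWith.const _)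
    (fun _ _ => ⟨fun _ => 0, fun _ _ _ => by simp, tendsto_const_nhds⟩)
  simpa using this

/-- The mass between two characteristics is conserved. -/
lemma measureReal_Ioc_characteristics (hv : IsTransportField T M L m v)
    (hm : IsWeakSolution T m v) (ha : IsCharacteristic T v a wa)
    (hb : IsCharacteristic T v b wb) {t : ℝ} (ht0 : 0 < t) (htT : t ≤ T)
    (h0 : a 0 ≤ b 0) (ht : a t ≤ b t) :
    (m t).real (Ioc (a t) (b t)) = (m 0).real (Ioc (a 0) (b 0)) := by
  have hT : 0 ≤ T := ht0.le.trans htT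
  have hu : uIoc 0 T ⊆ Icc 0 T := by rw [uIoc_of_le hT]; exact Ioc_subset_Icc_self
  obtain ⟨C, hC⟩ := exists_isStep_smoothTransition
  have := hv.finite t ⟨ht0.le, htT⟩
  have := hv.finite 0 ⟨le_rfl, hT⟩
  set H : (ℝ → ℝ) → (ℝ → ℝ) → ℕ → ℝ → ℝ := fun c w n s =>
    ∫ x, deriv (scaledStep n) (x - c s) * (v s x - w s) ∂(m s) with hH
  have hHcont : ∀ {c w}, IsCharacteristic T v c w → ∀ n, ContinuousOn (H c w n) (Icc 0 T) :=
    fun hc n => continuousOn_integral_flux hv hc (isStep_scaledStep hC n)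
  have hHlim : ∀ {c w}, IsCharacteristic T v c w → ∀ s ∈ Icc 0 T,
      Tendsto (fun n => H c w n s) atTop (𝓝 0) := fun {c w} hc s hs => by
    have := hv.finite s hs
    simp only [hH, hc.velocity_eq s hs]
    exact tendsto_integral_scaledFlux (m s) (hv.lipschitz s hs) (c s)
  have hHle : ∀ {c w}, IsCharacteristic T v c w → ∀ n, ∀ s ∈ Icc 0 T,
      |H c w n s| ≤ C * L * (m s).real univ := fun {c w} hc n s hs => by
    have := hv.finite s hs
    simp only [hH, hc.velocity_eq s hs]
    exact abs_integral_le_mul_measureReal _ (abs_scaledFlux_le hC (hv.lipschitz s hs) n (c s))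
  have hR : Tendsto (fun n => ∫ s in (0:ℝ)..T, |H a wa n s - H b wb n s|) atTop (𝓝 0) := by
    have hb0 : ContinuousOn (fun s => C * L * (m s).real univ + C * L * (m s).real univ)
        (uIcc 0 T) := by
      rw [uIcc_of_le hT]
      have := continuousOn_const (c := (C * L : ℝ)).mul (continuousOn_measureReal_univ hv)
      exact this.add this
    suffices h : Tendsto (fun n => ∫ s in (0:ℝ)..T, |H a wa n s - H b wb n s|) atTop
        (𝓝 (∫ _ in (0:ℝ)..T, (0:ℝ))) by rwa [intervalIntegral.integral_zero] at h
    refine intervalIntegral.tendsto_integral_filter_of_dominated_convergence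
      (fun s => C * L * (m s).real univ + C * L * (m s).real univ)
      (.of_forall fun n => ?_) (.of_forall fun n => .of_forall fun s hs => ?_)
      hb0.intervalIntegrable (.of_forall fun s hs => ?_)
    · exact ((((hHcont ha n).sub (hHcont hb n)).abs).mono hu).aestronglyMeasurable
        measurableSet_uIoc
    · rw [Real.norm_eq_abs, abs_abs]
      exact (abs_sub _ _).trans (add_le_add (hHle ha n s (hu hs)) (hHle hb n s (hu hs)))
    · simpa using ((hHlim ha s (hu hs)).sub (hHlim hb s (hu hs))).abs
  have hLlim := (((tendsto_integral_scaledStep (m t) (a t)).sub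
    (tendsto_integral_scaledStep (m t) (b t))).sub
    ((tendsto_integral_scaledStep (m 0) (a 0)).sub
      (tendsto_integral_scaledStep (m 0) (b 0)))).abs
  have hle := le_of_tendsto_of_tendsto' hLlim hR fun n =>
    abs_sub_stripMass_le hv hm ha hb (isStep_scaledStep hC n) ht0 htT
  have hIoc : ∀ (μ : Measure ℝ) [IsFiniteMeasure μ] {c d : ℝ}, c ≤ d →
      μ.real (Ioc c d) = μ.real (Ioi c) - μ.real (Ioi d) := fun μ _ c d hcd => by
    rw [← Ioi_sdiff_Ioi, measureReal_sdiff (Ioi_subset_Ioi hcd) measurableSet_Ioi]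
  rw [hIoc _ ht, hIoc _ h0]
  exact sub_eq_zero.1 (abs_nonpos_iff.1 hle)

end ScaledStep

section Flow

variable {T M : ℝ} {L : ℝ≥0} {m : ℝ → Measure ℝ} {v : ℝ → ℝ → ℝ} {α β : ℝ → ℝ}

lemma IsTransportField.continuousOn_comp (hv : IsTransportField T M L m v)
    (hα : ContinuousOn α (Icc 0 T)) : ContinuousOn (fun s => v s (α s)) (Icc 0 T) := by
  intro t ht
  refine tendsto_iff_dist_tendsto_zero.2 ?_
  have h1 : Tendsto (fun s => L * blDist (m s) (m t) + L * dist (α s) (α t)) (𝓝[Icc 0 T] t)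
      (𝓝 0) := by
    simpa using ((hv.tendsto_blDist t ht).const_mul (L : ℝ)).add
      ((tendsto_iff_dist_tendsto_zero.1 (hα t ht)).const_mul (L : ℝ))
  refine squeeze_zero' (.of_forall fun _ => dist_nonneg) ?_ h1
  filter_upwards [self_mem_nhdsWithin] with s hs
  exact (dist_triangle _ (v t (α s)) _).trans
    (add_le_add (hv.abs_sub_le t ht s hs _) ((hv.lipschitz t ht).dist_le_mul _ _))

/-- A solution on `[0,T]` of the ordinary differential equation with velocity field `v`. -/
def IsTrajectory (T : ℝ) (v : ℝ → ℝ → ℝ) (α : ℝ → ℝ) : Prop :=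
  ∀ t ∈ Icc 0 T, HasDerivWithinAt α (v t (α t)) (Icc 0 T) t

lemma IsTrajectory.continuousOn (hα : IsTrajectory T v α) : ContinuousOn α (Icc 0 T) :=
  fun t ht => (hα t ht).continuousWithinAt

lemma IsTransportField.exists_trajectory (hv : IsTransportField T M L m v) {t₀ : ℝ}
    (ht₀ : t₀ ∈ Icc 0 T) (y : ℝ) : ∃ α, α t₀ = y ∧ IsTrajectory T v α := by
  have hM : 0 ≤ M := (abs_nonneg _).trans (hv.abs_le t₀ ht₀ 0)
  have hp : IsPicardLindelof v (⟨t₀, ht₀⟩ : Icc 0 T) y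
      (M.toNNReal * (max (T - t₀) (t₀ - 0)).toNNReal) 0 M.toNNReal L :=
    { lipschitzOnWith := fun t ht => (hv.lipschitz t ht).lipschitzOnWith
      continuousOn := fun x _ => hv.continuousOn_comp continuousOn_const
      norm_le := fun t ht x _ => by
        rw [Real.coe_toNNReal _ hM]
        exact hv.abs_le t ht x
      mul_max_le := by
        rw [NNReal.coe_mul, NNReal.coe_zero, sub_zero, sub_zero,
          Real.coe_toNNReal (max _ _) (le_max_of_le_left (sub_nonneg.2 ht₀.2))] }
  exact hp.exists_eq_forall_mem_Icc_hasDerivWithinAt₀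

lemma IsTransportField.trajectory_unique (hv : IsTransportField T M L m v)
    (hα : IsTrajectory T v α) (hβ : IsTrajectory T v β) {t₀ : ℝ} (ht₀ : t₀ ∈ Icc 0 T)
    (h : α t₀ = β t₀) : EqOn α β (Icc 0 T) := by
  have hl : Icc 0 t₀ ⊆ Icc 0 T := Icc_subset_Icc_right ht₀.2
  have hr : Icc t₀ T ⊆ Icc 0 T := Icc_subset_Icc_left ht₀.1
  have hd : ∀ {γ}, IsTrajectory T v γ → ∀ t ∈ Ico t₀ T,
      HasDerivWithinAt γ (v t (γ t)) (Ici t) t := fun hγ t ht =>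
    (hγ t (hr (Ico_subset_Icc_self ht))).mono_of_mem_nhdsWithin
      (Icc_mem_nhdsGE_of_mem ⟨ht₀.1.trans ht.1, ht.2⟩)
  have hd' : ∀ {γ}, IsTrajectory T v γ → ∀ t ∈ Ioc 0 t₀,
      HasDerivWithinAt γ (v t (γ t)) (Iic t) t := fun hγ t ht =>
    (hγ t (hl (Ioc_subset_Icc_self ht))).mono_of_mem_nhdsWithin
      (Icc_mem_nhdsLE_of_mem ⟨ht.1, ht.2.trans ht₀.2⟩)
  rw [← Icc_union_Icc_eq_Icc ht₀.1 ht₀.2]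
  refine EqOn.union ?_ ?_
  · exact ODE_solution_unique_of_mem_Icc_left (s := fun _ => univ)
      (fun t ht => (hv.lipschitz t (hl (Ioc_subset_Icc_self ht))).lipschitzOnWith)
      (hα.continuousOn.mono hl) (hd' hα) (fun _ _ => trivial)
      (hβ.continuousOn.mono hl) (hd' hβ) (fun _ _ => trivial) h
  · exact ODE_solution_unique_of_mem_Icc_right (s := fun _ => univ)
      (fun t ht => (hv.lipschitz t (hr (Ico_subset_Icc_self ht))).lipschitzOnWith)
      (hα.continuousOn.mono hr) (hd hα) (fun _ _ => trivial)
      (hβ.continuousOn.mono hr) (hd hβ) (fun _ _ => trivial) h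

lemma IsTransportField.trajectory_lt (hv : IsTransportField T M L m v)
    (hα : IsTrajectory T v α) (hβ : IsTrajectory T v β) (h0 : α 0 < β 0) {t : ℝ}
    (ht : t ∈ Icc 0 T) : α t < β t := by
  by_contra! hle
  have hsub : Icc 0 t ⊆ Icc 0 T := Icc_subset_Icc_right ht.2
  have hcont : ContinuousOn (fun s => β s - α s) (Icc 0 t) :=
    (hβ.continuousOn.sub hα.continuousOn).mono hsub
  obtain ⟨s, hs, hs0⟩ := intermediate_value_Icc' ht.1 hcont
    (show (0 : ℝ) ∈ _ from ⟨sub_nonpos.2 hle, (sub_pos.2 h0).le⟩)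
  have := hv.trajectory_unique hα hβ (hsub hs) (sub_eq_zero.1 hs0).symm
    (show (0 : ℝ) ∈ Icc 0 T from ⟨le_rfl, ht.1.trans ht.2⟩)
  exact h0.ne this

/-- The velocity along a trajectory on `[0,T]`, extended to all times by constants. -/
noncomputable def extendedVelocity (hT : 0 ≤ T) (v : ℝ → ℝ → ℝ) (α : ℝ → ℝ) (s : ℝ) : ℝ :=
  v (projIcc 0 T hT s) (α (projIcc 0 T hT s))

lemma continuous_extendedVelocity (hT : 0 ≤ T) (hv : IsTransportField T M L m v)
    (hα : IsTrajectory T v α) : Continuous (extendedVelocity hT v α) :=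
  (continuousOn_iff_continuous_domRestrict.1 (hv.continuousOn_comp hα.continuousOn)).comp
    continuous_projIcc

lemma extendedVelocity_of_mem (hT : 0 ≤ T) {s : ℝ} (hs : s ∈ Icc 0 T) :
    extendedVelocity hT v α s = v s (α s) := by
  rw [extendedVelocity, projIcc_of_mem hT hs]

lemma add_integral_extendedVelocity (hT : 0 ≤ T) (hv : IsTransportField T M L m v)
    (hα : IsTrajectory T v α) {t : ℝ} (ht : t ∈ Icc 0 T) :
    α 0 + ∫ s in (0:ℝ)..t, extendedVelocity hT v α s = α t := by
  rw [intervalIntegral.integral_eq_sub_of_hasDerivAt_of_le ht.1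
    (hα.continuousOn.mono (Icc_subset_Icc_right ht.2)) (fun s hs => ?_)
    ((continuous_extendedVelocity hT hv hα).intervalIntegrable _ _), add_sub_cancel]
  have hs' : s ∈ Ioo 0 T := ⟨hs.1, hs.2.trans_le ht.2⟩
  rw [extendedVelocity_of_mem hT (Ioo_subset_Icc_self hs')]
  exact (hα s (Ioo_subset_Icc_self hs')).hasDerivAt (Icc_mem_nhds hs'.1 hs'.2)

lemma isCharacteristic_add_integral (hT : 0 ≤ T) (hv : IsTransportField T M L m v)
    (hα : IsTrajectory T v α) :
    IsCharacteristic T v (fun t => α 0 + ∫ s in (0:ℝ)..t, extendedVelocity hT v α s)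
      (extendedVelocity hT v α) where
  hasDerivAt s :=
    ((continuous_extendedVelocity hT hv hα).integral_hasStrictDerivAt 0 s).hasDerivAt.const_add _
  continuous_velocity := continuous_extendedVelocity hT hv hα
  velocity_eq s hs := by
    rw [extendedVelocity_of_mem hT hs, add_integral_extendedVelocity hT hv hα hs]

/-- A weak solution of the transport equation is the push-forward of its initial datum along the
flow of the velocity field. -/
theorem exists_flow_eq_map (hT : 0 ≤ T) (hv : IsTransportField T M L m v)
    (hm : IsWeakSolution T m v) :
    ∃ Φ : ℝ → ℝ → ℝ, (∀ t, Measurable (Φ t)) ∧ (∀ x, Φ 0 x = x) ∧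
      (∀ x, ∀ t ∈ Icc 0 T, HasDerivAt (fun τ => Φ τ x) (v t (Φ t x)) t) ∧
      ∀ t ∈ Icc 0 T, m t = Measure.map (Φ t) (m 0) := by
  have h0 : (0 : ℝ) ∈ Icc 0 T := left_mem_Icc.2 hT
  choose α hα0 hα using hv.exists_trajectory h0
  set Φ : ℝ → ℝ → ℝ := fun t x => α x 0 + ∫ s in (0:ℝ)..t, extendedVelocity hT v (α x) s with hΦ
  have hΦα : ∀ t ∈ Icc 0 T, ∀ x, Φ t x = α x t := fun t ht x =>
    add_integral_extendedVelocity hT hv (hα x) ht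
  have hΦ0 : ∀ x, Φ 0 x = x := fun x => (hΦα 0 h0 x).trans (hα0 x)
  have hchar : ∀ x, IsCharacteristic T v (fun t => Φ t x) (extendedVelocity hT v (α x)) :=
    fun x => isCharacteristic_add_integral hT hv (hα x)
  have hmono : ∀ t ∈ Icc 0 T, StrictMono fun x => α x t := fun t ht x y hxy =>
    hv.trajectory_lt (hα x) (hα y) (by rwa [hα0, hα0]) ht
  have hmeas : ∀ t, Measurable (Φ t) := fun t => by
    have hu : Measurable (Function.uncurry fun s x => extendedVelocity hT v (α x) s) :=
      measurable_uncurry_of_continuous_of_measurable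
        (fun x => continuous_extendedVelocity hT hv (hα x)) fun s =>
          (hv.lipschitz _ (projIcc 0 T hT s).2).continuous.measurable.comp
            (hmono _ (projIcc 0 T hT s).2).monotone.measurable
    have hi : ∀ S : Set ℝ, Measurable fun x => ∫ s in S, extendedVelocity hT v (α x) s := fun S =>
      (hu.comp measurable_swap).stronglyMeasurable.integral_prod_right'.measurable
    simp only [hΦ, hα0, intervalIntegral]
    exact measurable_id.add ((hi _).sub (hi _))
  refine ⟨Φ, hmeas, hΦ0, fun x t ht => ?_, fun t ht => ?_⟩
  · rw [← (hchar x).velocity_eq t ht]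
    exact (hchar x).hasDerivAt t
  have := hv.finite t ht
  have := hv.finite 0 h0
  rcases ht.1.eq_or_lt with rfl | htpos
  · rw [show Φ 0 = id from funext hΦ0, Measure.map_id]
  have hmonoΦ : StrictMono (Φ t) := by
    rw [funext (hΦα t ht)]
    exact hmono t ht
  have hsurj : Function.Surjective (Φ t) := fun y => by
    obtain ⟨β, hβt, hβ⟩ := hv.exists_trajectory ht y
    exact ⟨β 0, by rw [hΦα t ht, hv.trajectory_unique (hα (β 0)) hβ h0 (hα0 _) ht, hβt]⟩
  refine Measure.ext_of_Ioc _ _ fun c d hcd => ?_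
  obtain ⟨x, rfl⟩ := hsurj c
  obtain ⟨y, rfl⟩ := hsurj d
  have hxy : x < y := hmonoΦ.lt_iff_lt.1 hcd
  have hpre : Φ t ⁻¹' Ioc (Φ t x) (Φ t y) = Ioc x y := by
    ext z
    simp [hmonoΦ.lt_iff_lt, hmonoΦ.le_iff_le]
  rw [Measure.map_apply (hmeas t) measurableSet_Ioc, hpre, ← measureReal_eq_measureReal_iff]
  simpa only [hΦ0] using measureReal_Ioc_characteristics hv hm (hchar x) (hchar y) htpos ht.2
    (by rw [hΦ0, hΦ0]; exact hxy.le) hcd.le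

end Flow

/-- Representation formula: any measure-valued solution of the nonlinear
transport equation is the push-forward of the initial datum along the characteristic
flow of the velocity field (x,t) ↦ V(m_t)(x). -/
theorem mv_solution_is_pushforward (T : ℝ) (hT : 0 < T) (Vmax L : ℝ)
    (V : Measure ℝ → ℝ → ℝ)
    (H1 : ∀ (μ : Measure ℝ), IsFiniteMeasure μ → ∀ x, 0 ≤ V μ x ∧ V μ x ≤ Vmax)
    (H2 : ∀ (μ : Measure ℝ), IsFiniteMeasure μ → ∀ x y, |V μ x - V μ y| ≤ L * |x - y|)
    (H3 : ∀ (μ₁ μ₂ : Measure ℝ), IsFiniteMeasure μ₁ → IsFiniteMeasure μ₂ →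
      ∀ x, |V μ₁ x - V μ₂ x| ≤ L * blDist μ₁ μ₂)
    (μ₀ : Measure ℝ) [IsFiniteMeasure μ₀]
    (m : ℝ → Measure ℝ) (hm : IsMVSolution T V μ₀ m) :
    ∃ Φ : ℝ → ℝ → ℝ, (∀ t, Measurable (Φ t)) ∧ (∀ x, Φ 0 x = x) ∧
      (∀ x, ∀ t ∈ Set.Icc (0:ℝ) T,
        HasDerivAt (fun τ => Φ τ x) (V (m t) (Φ t x)) t) ∧
      ∀ t ∈ Set.Icc (0:ℝ) T, m t = Measure.map (Φ t) μ₀ := by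
  obtain ⟨hfin, hcont, rfl, hweak⟩ := hm
  refine exists_flow_eq_map hT.le (M := Vmax) (L := L.toNNReal) (v := fun t => V (m t)) ?_ hweak
  have hL : 0 ≤ L := by
    have h := H2 0 inferInstance 0 1
    norm_num at h
    exact (abs_nonneg _).trans h
  refine ⟨hfin, fun t ht => ?_, fun t ht x => ?_, fun t ht => ?_, fun t ht s hs x => ?_⟩
  · refine Metric.tendsto_nhdsWithin_nhds.2 fun ε hε => ?_
    obtain ⟨δ, hδ, h⟩ := hcont t ht ε hε
    refine ⟨δ, hδ, fun s hs hst => ?_⟩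
    rw [Real.dist_0_eq_abs, abs_of_nonneg (blDist_nonneg _ _)]
    exact h s hs hst
  · obtain ⟨h0, h1⟩ := H1 (m t) (hfin t ht) x
    rwa [abs_of_nonneg h0]
  · refine LipschitzWith.of_dist_le_mul fun x y => ?_
    rw [Real.coe_toNNReal _ hL]
    exact H2 (m t) (hfin t ht) x y
  · rw [Real.coe_toNNReal _ hL]
    exact H3 (m s) (m t) (hfin s hs) (hfin t ht) x
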